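/- Bob has a winning strategy in the modified synchronization game on the DFA ℱ: there exists a map g from {a,b,c} to words over {a,b,c} (namely g(a) = b, g(b) = bb, g(c) = bb) such that for every finite sequence x₁,…,x_k of letters from {a,b,c}, the set {q·(x₁ g(x₁) x₂ g(x₂) ⋯ x_k g(x_k)) : q ∈ {0,1,2}} contains at least two states; in particular no word of this form is a reset word for ℱ, so Bob can keep at least two tokens forever. -/

import Mathlib

open MulOpposite

variable {Q σ : Type*}

/-- The action of a word on a state: `q·w`. -/
def run (step : Q → σ → Q) (q : Q) (w : List σ) : Q := w.foldl step q

/-- A reset word. -/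
def IsReset (step : Q → σ → Q) (w : List σ) : Prop :=
  ∀ p q : Q, run step p w = run step q w

/-- The interleaving `a₁b₁a₂b₂⋯` of two words. -/
def interleave {α : Type*} (as bs : List α) : List α :=
  (as.zip bs).flatMap fun p => [p.1, p.2]

/-- The input alphabet `{a, b, c}`. -/
inductive Letter : Type
  | a | b | c
deriving DecidableEq

/-- The transition function of the automaton ℱ on states `{0, 1, 2}` (as `Fin 3`):
under `a`: 0↦1, 1↦1, 2↦2; under `b`: 0↦1, 1↦2, 2↦0; under `c`: 0↦0, 1↦1, 2↦1. -/
def stepF : Fin 3 → Letter → Fin 3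
  | q, .a => ![1, 1, 2] q
  | q, .b => ![1, 2, 0] q
  | q, .c => ![0, 1, 1] q

/-- Bob has a winning strategy in the modified synchronization
game on ℱ: there is a map `g` from letters to words (namely `g(a) = b`,
`g(b) = g(c) = bb`) such that no word of the form `x₁ g(x₁) ⋯ x_k g(x_k)` is a
reset word for ℱ. -/
theorem F_bob_wins_modified_game :
    ∃ g : Letter → List Letter,
      g Letter.a = [Letter.b] ∧
      g Letter.b = [Letter.b, Letter.b] ∧
      g Letter.c = [Letter.b, Letter.b] ∧
      ∀ xs : List Letter, ∃ p q : Fin 3,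
        run stepF p (xs.flatMap fun x => x :: g x) ≠
          run stepF q (xs.flatMap fun x => x :: g x) := by
  refine ⟨fun x => match x with
    | .a => [Letter.b]
    | .b => [Letter.b, Letter.b]
    | .c => [Letter.b, Letter.b], rfl, rfl, rfl, ?_⟩
  have key : ∀ (g : Letter → List Letter), g Letter.a = [Letter.b] →
      g Letter.b = [Letter.b, Letter.b] → g Letter.c = [Letter.b, Letter.b] →
      ∀ (xs : List Letter) (p q : Fin 3), (p = 0 ∧ q = 2 ∨ p = 2 ∧ q = 0) →
        run stepF p (xs.flatMap fun x => x :: g x) ≠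
          run stepF q (xs.flatMap fun x => x :: g x) := by
    intro g ha hb hc xs
    induction xs with
    | nil =>
      rintro p q (⟨rfl, rfl⟩ | ⟨rfl, rfl⟩) <;> simp [run]
    | cons x xs ih =>
      intro p q h
      simp only [run, List.flatMap_cons, List.foldl_append] at ih ⊢
      apply ih
      rcases h with ⟨rfl, rfl⟩ | ⟨rfl, rfl⟩ <;> cases x <;>
        simp only [ha, hb, hc, List.foldl] <;> decide
  intro xs
  exact ⟨0, 2, key _ rfl rfl rfl xs 0 2 (Or.inl ⟨rfl, rfl⟩)⟩
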